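/- Let α ≥ 2, let a, b, P_max > 0, γ_t, γ_r > 0, μ_t, μ_r ≥ 0 and C > 0 be real constants. Then the set of tuples (p_t, p_r, β_t, β_r, D_t, D_r, D₀) ∈ ℝ⁷ satisfying: β_t > 0, β_r > 0, β_t + β_r = 1, D_t ≥ 1, D_r ≥ 1, D_t ≥ μ_t D₀, D_r ≥ μ_r D₀, p_t + p_r ≤ P_max, β_r ≤ C β_t, (2^{γ_t} − 1)(a D_t^α / β_t + p_r) ≤ p_t, and (2^{γ_r} − 1) b D_r^α / β_r ≤ p_r, is a convex subset of ℝ⁷. -/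

import Mathlib

theorem aux_tangent (x q β : ℝ) (hβ : 0 < β) : 2 * x * q - q ^ 2 * β ≤ x ^ 2 / β := by
  rw [le_div_iff₀ hβ]
  nlinarith [sq_nonneg (x - q * β)]

theorem aux_persp (α D1 D2 β1 β2 s t : ℝ) (hα : 2 ≤ α) (h1 : 1 ≤ D1) (h2 : 1 ≤ D2)
    (hβ1 : 0 < β1) (hβ2 : 0 < β2) (hs : 0 ≤ s) (ht : 0 ≤ t) (hst : s + t = 1)
    (hB : 0 < s * β1 + t * β2) :
    (s * D1 + t * D2) ^ α / (s * β1 + t * β2) ≤ s * (D1 ^ α / β1) + t * (D2 ^ α / β2) := by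
  have hsq : ∀ D : ℝ, 0 ≤ D → D ^ α = (D ^ (α / 2)) ^ 2 := by
    intro D hD
    rw [← Real.rpow_natCast, ← Real.rpow_mul hD]
    congr 1
    push_cast
    ring
  have hD : 0 ≤ s * D1 + t * D2 := by
    have := mul_nonneg hs (by linarith : (0 : ℝ) ≤ D1)
    have := mul_nonneg ht (by linarith : (0 : ℝ) ≤ D2)
    linarith
  have hc := (convexOn_rpow (by linarith : 1 ≤ α / 2)).2
    (show D1 ∈ Set.Ici (0 : ℝ) from by simp; linarith)
    (show D2 ∈ Set.Ici (0 : ℝ) from by simp; linarith) hs ht hst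
  simp only [smul_eq_mul] at hc
  rw [hsq _ hD, hsq D1 (by linarith), hsq D2 (by linarith)]
  have h0 := Real.rpow_nonneg hD (α / 2)
  generalize (s * D1 + t * D2) ^ (α / 2) = z at *
  generalize D1 ^ (α / 2) = x at *
  generalize D2 ^ (α / 2) = y at *
  have e1 := mul_le_mul_of_nonneg_left (aux_tangent x (z / (s * β1 + t * β2)) β1 hβ1) hs
  have e2 := mul_le_mul_of_nonneg_left (aux_tangent y (z / (s * β1 + t * β2)) β2 hβ2) ht
  have hq : 0 ≤ z / (s * β1 + t * β2) := by positivity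
  have hz : z = z / (s * β1 + t * β2) * (s * β1 + t * β2) := by field_simp
  have hg : z ^ 2 / (s * β1 + t * β2) = z * (z / (s * β1 + t * β2)) := by ring
  rw [hg]
  generalize z / (s * β1 + t * β2) = q at *
  have e3 := mul_le_mul_of_nonneg_right hc hq
  have e4 : q ^ 2 * (s * β1 + t * β2) = z * q := by rw [hz]; ring
  linarith

/-- Convexity of the feasible set of the transformed NOMA problem (11)
(decoding order λ(r) = 1). Coordinates: (p_t, p_r, β_t, β_r, D_t, D_r, D₀). -/
theorem stmt_9 (α a b Pmax γt γr μt μr C : ℝ)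
    (hα : 2 ≤ α) (ha : 0 < a) (hb : 0 < b) (hP : 0 < Pmax)
    (hγt : 0 < γt) (hγr : 0 < γr) (hμt : 0 ≤ μt) (hμr : 0 ≤ μr) (hC : 0 < C) :
    Convex ℝ {v : ℝ × ℝ × ℝ × ℝ × ℝ × ℝ × ℝ |
      0 < v.2.2.1 ∧ 0 < v.2.2.2.1 ∧ v.2.2.1 + v.2.2.2.1 = 1 ∧
      1 ≤ v.2.2.2.2.1 ∧ 1 ≤ v.2.2.2.2.2.1 ∧
      μt * v.2.2.2.2.2.2 ≤ v.2.2.2.2.1 ∧ μr * v.2.2.2.2.2.2 ≤ v.2.2.2.2.2.1 ∧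
      v.1 + v.2.1 ≤ Pmax ∧
      v.2.2.2.1 ≤ C * v.2.2.1 ∧
      ((2 : ℝ) ^ γt - 1) * (a * v.2.2.2.2.1 ^ α / v.2.2.1 + v.2.1) ≤ v.1 ∧
      ((2 : ℝ) ^ γr - 1) * b * v.2.2.2.2.2.1 ^ α / v.2.2.2.1 ≤ v.2.1} := by
  have hgt : 0 ≤ (2 : ℝ) ^ γt - 1 := by
    linarith [Real.one_le_rpow (by norm_num : (1 : ℝ) ≤ 2) hγt.le]
  have hgr : 0 ≤ (2 : ℝ) ^ γr - 1 := by
    linarith [Real.one_le_rpow (by norm_num : (1 : ℝ) ≤ 2) hγr.le]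
  generalize (2 : ℝ) ^ γt - 1 = gt at *
  generalize (2 : ℝ) ^ γr - 1 = gr at *
  rintro ⟨p1, r1, x1, y1, T1, R1, D1⟩ ⟨a1, a2, a3, a4, a5, a6, a7, a8, a9, a10, a11⟩
    ⟨p2, r2, x2, y2, T2, R2, D2⟩ ⟨b1, b2, b3, b4, b5, b6, b7, b8, b9, b10, b11⟩ s t hs ht hst
  have conv : ∀ {u v u' v' : ℝ}, u ≤ v → u' ≤ v' → s * u + t * u' ≤ s * v + t * v' :=
    fun h h' => add_le_add (mul_le_mul_of_nonneg_left h hs) (mul_le_mul_of_nonneg_left h' ht)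
  have pos : ∀ {u u' : ℝ}, 0 < u → 0 < u' → 0 < s * u + t * u' := by
    intro u u' h h'
    exact (convex_Ioi (0 : ℝ)) h h' hs ht hst
  simp only [Set.mem_setOf_eq, Prod.smul_mk, Prod.mk_add_mk, smul_eq_mul] at *
  have k1 := aux_persp α T1 T2 x1 x2 s t hα a4 b4 a1 b1 hs ht hst (pos a1 b1)
  have k2 := aux_persp α R1 R2 y1 y2 s t hα a5 b5 a2 b2 hs ht hst (pos a2 b2)
  refine ⟨pos a1 b1, pos a2 b2, ?_, ?_, ?_, ?_, ?_, ?_, ?_, ?_, ?_⟩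
  · linear_combination s * a3 + t * b3 + hst
  · linarith [conv a4 b4]
  · linarith [conv a5 b5]
  · linarith [conv a6 b6]
  · linarith [conv a7 b7]
  · have := conv a8 b8
    rw [← add_mul, hst] at this
    linarith
  · linarith [conv a9 b9]
  · refine le_trans ?_ (conv a10 b10)
    have := mul_le_mul_of_nonneg_left k1 (mul_nonneg hgt ha.le)
    simp only [mul_div_assoc]
    linarith
  · refine le_trans ?_ (conv a11 b11)
    have := mul_le_mul_of_nonneg_left k2 (mul_nonneg hgr hb.le)
    simp only [mul_div_assoc]
    linarith
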